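/- arXiv:1810.09547 — 2 statements merged into one kernel-verified Lean document; each statement's English description precedes it below -/
import Mathlib

section
/- Let α ≥ 0 and k, a > 0. Define, for z > 0 and h₀ > 0, f(z) = 1/(z·M(α/2 + 1, 3/2, z²)) and f₁(z, h₀) = 1/( (k/(2·a·h₀))·M(α/2 + 1/2, 1/2, z²) + z·M(α/2 + 1, 3/2, z²) ). Then f(z) − f₁(z, h₀) > 0 for all z > 0 and all h₀ > 0. Consequently, if β, δ are real constants with β ≥ max(δ, −1−δ), α = β − δ, and γ, u_∞ > 0, then the unique positive root ξ_R(h₀) of (k·u_∞/(γ·2^{β+1}·a^{β+δ+2}))·f₁(z, h₀) = z^{β+δ+1} and the unique positive root ξ_{D∞} of (k·u_∞/(γ·2^{β+1}·a^{β+δ+2}))·f(z) = z^{β+δ+1} satisfy 0 < ξ_R(h₀) < ξ_{D∞} for every h₀ > 0. -/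
/-- Kummer's confluent hypergeometric function
`M(a,b,z) = ∑ (a)_n / (b)_n · zⁿ/n!`, with `(a)_n` the rising factorial. -/
noncomputable def kummerM (a b z : ℝ) : ℝ :=
  ∑' n : ℕ, ((ascPochhammer ℝ n).eval a / (ascPochhammer ℝ n).eval b) * z ^ n / (n.factorial : ℝ)

lemma summable_kummerM {a b : ℝ} (ha : 0 < a) (hb : 0 < b) {z : ℝ} (hz : 0 ≤ z) :
    Summable fun n : ℕ ↦
      ((ascPochhammer ℝ n).eval a / (ascPochhammer ℝ n).eval b) * z ^ n / (n.factorial : ℝ) := by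
  set c : ℝ := max 1 (a / b)
  have hc : 1 ≤ c := le_max_left _ _
  have hab : a ≤ c * b := (div_le_iff₀ hb).1 (le_max_right _ _)
  have key (n : ℕ) : (ascPochhammer ℝ n).eval a ≤ c ^ n * (ascPochhammer ℝ n).eval b := by
    induction n with
    | zero => simp
    | succ n ih =>
      have hstep : a + n ≤ c * (b + n) := by
        nlinarith [mul_nonneg (sub_nonneg.2 hc) (Nat.cast_nonneg (α := ℝ) n)]
      rw [ascPochhammer_succ_eval, ascPochhammer_succ_eval]
      calc (ascPochhammer ℝ n).eval a * (a + n)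
          ≤ (c ^ n * (ascPochhammer ℝ n).eval b) * (c * (b + n)) :=
            mul_le_mul ih hstep (by positivity)
              (mul_nonneg (by positivity) (ascPochhammer_pos n b hb).le)
        _ = c ^ (n + 1) * ((ascPochhammer ℝ n).eval b * (b + n)) := by ring
  refine Summable.of_nonneg_of_le (fun n ↦ ?_) (fun n ↦ ?_) (Real.summable_pow_div_factorial (c * z))
  · have := ascPochhammer_pos n a ha
    have := ascPochhammer_pos n b hb
    positivity
  · rw [mul_pow]
    gcongr
    exact (div_le_iff₀ (ascPochhammer_pos n b hb)).2 (key n)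

lemma kummerM_pos {a b : ℝ} (ha : 0 < a) (hb : 0 < b) {z : ℝ} (hz : 0 ≤ z) :
    0 < kummerM a b z := by
  refine (summable_kummerM ha hb hz).tsum_pos (fun n ↦ ?_) 0 (by simp)
  have := ascPochhammer_pos n a ha
  have := ascPochhammer_pos n b hb
  positivity

lemma kummerM_le_kummerM {a b : ℝ} (ha : 0 < a) (hb : 0 < b) {x y : ℝ} (hx : 0 ≤ x)
    (hxy : x ≤ y) : kummerM a b x ≤ kummerM a b y := by
  refine (summable_kummerM ha hb hx).tsum_le_tsum (fun n ↦ ?_)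
    (summable_kummerM ha hb (hx.trans hxy))
  have := ascPochhammer_pos n a ha
  have := ascPochhammer_pos n b hb
  gcongr

/-- `f(z) − f₁(z,h₀) > 0` for all `z > 0`, `h₀ > 0`; consequently the positive root
`ξ_R(h₀)` of the Robin equation and the positive root `ξ_{D∞}` of the Dirichlet equation
satisfy `0 < ξ_R(h₀) < ξ_{D∞}`. -/
theorem stmt17 (α k a : ℝ) (hα : 0 ≤ α) (hk : 0 < k) (ha : 0 < a) :
    (∀ z h₀ : ℝ, 0 < z → 0 < h₀ →
      1 / (z * kummerM (α/2 + 1) (3/2) (z^2)) -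
        1 / ((k / (2 * a * h₀)) * kummerM (α/2 + 1/2) (1/2) (z^2) +
          z * kummerM (α/2 + 1) (3/2) (z^2)) > 0) ∧
    (∀ β δ γ uinf : ℝ, β ≥ max δ (-1 - δ) → α = β - δ → 0 < γ → 0 < uinf →
      ∀ h₀ ξR ξD : ℝ, 0 < h₀ →
        (0 < ξR ∧ (k * uinf / (γ * (2:ℝ) ^ (β + 1) * a ^ (β + δ + 2))) *
          (1 / ((k / (2 * a * h₀)) * kummerM (α/2 + 1/2) (1/2) (ξR^2) +
            ξR * kummerM (α/2 + 1) (3/2) (ξR^2))) = ξR ^ (β + δ + 1)) →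
        (0 < ξD ∧ (k * uinf / (γ * (2:ℝ) ^ (β + 1) * a ^ (β + δ + 2))) *
          (1 / (ξD * kummerM (α/2 + 1) (3/2) (ξD^2))) = ξD ^ (β + δ + 1)) →
        0 < ξR ∧ ξR < ξD) := by
  have hM (z : ℝ) : 0 < kummerM (α/2 + 1) (3/2) (z^2) :=
    kummerM_pos (by positivity) (by norm_num) (sq_nonneg z)
  have hN (z : ℝ) : 0 < kummerM (α/2 + 1/2) (1/2) (z^2) :=
    kummerM_pos (by positivity) (by norm_num) (sq_nonneg z)
  have hlt (z h₀ : ℝ) (hz : 0 < z) (hh : 0 < h₀) :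
      1 / ((k / (2 * a * h₀)) * kummerM (α/2 + 1/2) (1/2) (z^2) +
        z * kummerM (α/2 + 1) (3/2) (z^2)) < 1 / (z * kummerM (α/2 + 1) (3/2) (z^2)) := by
    have := hN z
    exact one_div_lt_one_div_of_lt (mul_pos hz (hM z)) (lt_add_of_pos_left _ (by positivity))
  refine ⟨fun z h₀ hz hh ↦ sub_pos.2 (hlt z h₀ hz hh), ?_⟩
  rintro β δ γ uinf hβ - hγ hu h₀ ξR ξD hh ⟨hR, eR⟩ ⟨hD, eD⟩
  refine ⟨hR, lt_of_not_ge fun hle ↦ ?_⟩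
  have hp : 0 ≤ β + δ + 1 := by linarith [le_max_right δ (-1 - δ)]
  have hC : 0 < k * uinf / (γ * (2:ℝ) ^ (β + 1) * a ^ (β + δ + 2)) := by positivity
  have hpow := Real.rpow_le_rpow hD.le hle hp
  have hanti : 1 / (ξR * kummerM (α/2 + 1) (3/2) (ξR^2)) ≤
      1 / (ξD * kummerM (α/2 + 1) (3/2) (ξD^2)) :=
    one_div_le_one_div_of_le (mul_pos hD (hM ξD)) <| mul_le_mul hle
      (kummerM_le_kummerM (by positivity) (by norm_num) (sq_nonneg _) (by gcongr))
      (hM ξD).le hR.le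
  have hroots := mul_lt_mul_of_pos_left ((hlt ξR h₀ hR hh).trans_le hanti) hC
  rw [eR, eD] at hroots
  exact absurd hpow hroots.not_ge
end

section
/- (Theorem 4.1, convergence of the Robin solution to the Dirichlet solution.) Under the hypotheses and notation of the convergence of ξ_R(h₀) to ξ_{D∞}: let s_R(t,h₀) = 2·ξ_R(h₀)·a√t and u_R(x,t,h₀) = t^{α/2}·[C_{1R}(h₀)·M(−α/2, 1/2, −η²) + C_{2R}(h₀)·η·M(−α/2 + 1/2, 3/2, −η²)] with η = x/(2a√t), where C_{1R}(h₀) = u_∞·ξ_R(h₀)·M(−α/2 + 1/2, 3/2, −ξ_R(h₀)²)/D(h₀), C_{2R}(h₀) = −u_∞·M(−α/2, 1/2, −ξ_R(h₀)²)/D(h₀), and D(h₀) = (k/(2·a·h₀))·M(−α/2, 1/2, −ξ_R(h₀)²) + ξ_R(h₀)·M(−α/2 + 1/2, 3/2, −ξ_R(h₀)²); and let s_{D∞}(t) = 2·ξ_{D∞}·a√t and u_{D∞}(x,t) = t^{α/2}·[u_∞·M(−α/2, 1/2, −η²) − (u_∞·M(−α/2, 1/2, −ξ_{D∞}²)/(ξ_{D∞}·M(−α/2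 + 1/2, 3/2, −ξ_{D∞}²)))·η·M(−α/2 + 1/2, 3/2, −η²)]. Then for every t > 0, s_R(t,h₀) → s_{D∞}(t) as h₀ → +∞, and for every t > 0 and x > 0, u_R(x,t,h₀) → u_{D∞}(x,t) as h₀ → +∞. -/
lemma abs_ascPochhammer_div_le (a : ℝ) {b : ℝ} (hb : 0 < b) (n : ℕ) :
    |(ascPochhammer ℝ n).eval a / (ascPochhammer ℝ n).eval b| ≤ (|a| / b + 1) ^ n := by
  induction n with
  | zero => simp
  | succ n ih =>
    have hbn : 0 < b + n := by positivity
    rw [ascPochhammer_succ_eval, ascPochhammer_succ_eval, mul_div_mul_comm, abs_mul, pow_succ]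
    gcongr
    rw [abs_div, abs_of_pos hbn, div_le_iff₀ hbn]
    calc |a + n| ≤ |a| + n := by
          simpa using abs_add_le a (n : ℝ)
      _ ≤ |a| + n + (b + |a| / b * n) := le_add_of_nonneg_right (by positivity)
      _ = (|a| / b + 1) * (b + n) := by field_simp; ring

lemma norm_kummerM_term_le (a : ℝ) {b z R : ℝ} (hb : 0 < b) (hz : |z| ≤ R) (n : ℕ) :
    ‖(ascPochhammer ℝ n).eval a / (ascPochhammer ℝ n).eval b * z ^ n / (n.factorial : ℝ)‖ ≤
      ((|a| / b + 1) * R) ^ n / (n.factorial : ℝ) := by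
  rw [Real.norm_eq_abs, abs_div, abs_mul, abs_pow, mul_pow, Nat.abs_cast]
  gcongr
  exact abs_ascPochhammer_div_le a hb n

lemma summable_norm_kummerM (a : ℝ) {b : ℝ} (hb : 0 < b) (z : ℝ) :
    Summable fun n : ℕ => ‖(ascPochhammer ℝ n).eval a / (ascPochhammer ℝ n).eval b * z ^ n /
      (n.factorial : ℝ)‖ :=
  (Real.summable_pow_div_factorial _).of_nonneg_of_le (fun _ => norm_nonneg _)
    (norm_kummerM_term_le a hb le_rfl)

lemma continuous_kummerM (a : ℝ) {b : ℝ} (hb : 0 < b) : Continuous (kummerM a b) := by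
  refine continuous_iff_continuousAt.2 fun z => ?_
  have hcont : ContinuousOn (kummerM a b) (Metric.closedBall 0 (|z| + 1)) :=
    continuousOn_tsum (fun n => by fun_prop)
      (Real.summable_pow_div_factorial ((|a| / b + 1) * (|z| + 1)))
      fun n x hx => norm_kummerM_term_le a hb (by simpa using hx) n
  exact hcont.continuousAt (Metric.closedBall_mem_nhds_of_mem (by simp))

lemma one_le_kummerM {a b z : ℝ} (ha : 0 < a) (hb : 0 < b) (hz : 0 ≤ z) :
    1 ≤ kummerM a b z := by
  have h := (summable_norm_kummerM a hb z).of_norm.le_tsum 0 fun n _ => by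
    have := ascPochhammer_pos n a ha
    have := ascPochhammer_pos n b hb
    positivity
  simpa [kummerM] using h

lemma kummerM_le_kummerM_s19 {a b z w : ℝ} (ha : 0 < a) (hb : 0 < b) (hz : 0 ≤ z) (hzw : z ≤ w) :
    kummerM a b z ≤ kummerM a b w := by
  refine (summable_norm_kummerM a hb z).of_norm.tsum_le_tsum (fun n => ?_)
    (summable_norm_kummerM a hb w).of_norm
  have := ascPochhammer_pos n a ha
  have := ascPochhammer_pos n b hb
  gcongr

/-- Chu–Vandermonde summation `₂F₁(-n, c; b; 1) = (b - c)_n / (b)_n`. -/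
lemma sum_choose_mul_ascPochhammer_div (n : ℕ) (c : ℝ) {b : ℝ} (hb : 0 < b) :
    ∑ ij ∈ Finset.HasAntidiagonal.antidiagonal n, (n.choose ij.1 : ℝ) *
        ((-1) ^ ij.1 * ((ascPochhammer ℝ ij.1).eval c / (ascPochhammer ℝ ij.1).eval b)) =
      (ascPochhammer ℝ n).eval (b - c) / (ascPochhammer ℝ n).eval b := by
  have succ_left (m : ℕ) (x : ℝ) :
      (ascPochhammer ℝ (m + 1)).eval x = x * (ascPochhammer ℝ m).eval (x + 1) := by
    simp [ascPochhammer_succ_left]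
  induction n generalizing b c with
  | zero => simp
  | succ n ih =>
    rw [Finset.sum_antidiagonal_choose_succ_mul (fun i _ => (-1 : ℝ) ^ i *
      ((ascPochhammer ℝ i).eval c / (ascPochhammer ℝ i).eval b)), ih c hb]
    have hshift : ∑ ij ∈ Finset.HasAntidiagonal.antidiagonal n, (n.choose ij.2 : ℝ) * ((-1 : ℝ) ^ (ij.1 + 1) *
        ((ascPochhammer ℝ (ij.1 + 1)).eval c / (ascPochhammer ℝ (ij.1 + 1)).eval b)) =
        -(c / b) * ((ascPochhammer ℝ n).eval (b - c) / (ascPochhammer ℝ n).eval (b + 1)) := by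
      have h := ih (c + 1) (b := b + 1) (by linarith)
      rw [add_sub_add_right_eq_sub] at h
      rw [← h, Finset.mul_sum]
      refine Finset.sum_congr rfl fun ij hij => ?_
      rw [succ_left, succ_left, ← Finset.HasAntidiagonal.mem_antidiagonal.1 hij, Nat.choose_symm_add]
      ring
    have hn := ascPochhammer_pos n b hb
    have hn' := ascPochhammer_pos n (b + 1) (by linarith)
    have hbn : 0 < b + n := by positivity
    have hrel : (ascPochhammer ℝ n).eval b * (b + n) = b * (ascPochhammer ℝ n).eval (b + 1) := by
      rw [← ascPochhammer_succ_eval, succ_left]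
    rw [hshift, ascPochhammer_succ_eval, ascPochhammer_succ_eval]
    have hinv : (ascPochhammer ℝ n).eval (b + 1) = (ascPochhammer ℝ n).eval b * (b + n) / b := by
      rw [hrel]; field_simp
    rw [hinv]
    field_simp
    ring

/-- Kummer's transformation. -/
lemma exp_neg_mul_kummerM (c : ℝ) {b : ℝ} (hb : 0 < b) (z : ℝ) :
    Real.exp (-z) * kummerM c b z = kummerM (b - c) b (-z) := by
  have hexp : Real.exp (-z) = ∑' n : ℕ, (-z) ^ n / (n.factorial : ℝ) := by
    rw [Real.exp_eq_exp_ℝ, NormedSpace.exp_eq_tsum_div]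
  rw [mul_comm, hexp, kummerM, kummerM, tsum_mul_tsum_eq_tsum_sum_antidiagonal_of_summable_norm
    (summable_norm_kummerM c hb z) (Real.summable_pow_div_factorial _).norm]
  refine tsum_congr fun n => ?_
  rw [← sum_choose_mul_ascPochhammer_div n c hb, Finset.sum_mul, Finset.sum_div]
  refine Finset.sum_congr rfl fun ij hij => ?_
  obtain rfl := Finset.HasAntidiagonal.mem_antidiagonal.1 hij
  rw [Nat.cast_add_choose, neg_pow z, neg_pow z, pow_add, pow_add]
  have hsq : ((-1 : ℝ) ^ ij.1) * (-1) ^ ij.1 = 1 := by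
    rw [← mul_pow]; norm_num
  field_simp
  linear_combination (-((ascPochhammer ℝ ij.1).eval c * z ^ ij.1 * z ^ ij.2 /
    (ascPochhammer ℝ ij.1).eval b)) * hsq

lemma kummerM_neg_pos {a b z : ℝ} (hb : 0 < b) (hab : a < b) (hz : 0 ≤ z) :
    0 < kummerM a b (-z) := by
  have h := exp_neg_mul_kummerM (b - a) hb z
  rw [sub_sub_cancel] at h
  rw [← h]
  exact mul_pos (Real.exp_pos _)
    (one_pos.trans_le (one_le_kummerM (sub_pos.2 hab) hb hz))

/-- Roots `ξ ε` of `z ^ p * (ε * A z + z * B z) = K`, with `A`, `B` positive and nondecreasing,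
converge to the root for `ε = 0` as `ε` tends to `0` from above. -/
lemma tendsto_root_of_monotone {ι : Type*} {l : Filter ι} {A B : ℝ → ℝ} {p K ξ₀ : ℝ}
    {ε ξ : ι → ℝ} (hp : 0 ≤ p) (hξ₀ : 0 < ξ₀)
    (hA : ∀ z, 0 < z → 0 < A z) (hB : ∀ z, 0 < z → 0 < B z)
    (hAm : MonotoneOn A (Set.Ioi 0)) (hBm : MonotoneOn B (Set.Ioi 0))
    (hε : Filter.Tendsto ε l (nhds 0)) (hεpos : ∀ᶠ i in l, 0 < ε i) (hξ : ∀ᶠ i in l, 0 < ξ i)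
    (hroot : ∀ᶠ i in l, ξ i ^ p * (ε i * A (ξ i) + ξ i * B (ξ i)) = K)
    (hroot₀ : ξ₀ ^ p * (ξ₀ * B ξ₀) = K) :
    Filter.Tendsto ξ l (nhds ξ₀) := by
  refine tendsto_order.2 ⟨fun c hc => ?_, fun c hc => ?_⟩
  · set d := max c (ξ₀ / 2)
    have hd0 : 0 < d := lt_max_of_lt_right (by positivity)
    have hdξ : d < ξ₀ := max_lt hc (by linarith)
    have hlim : Filter.Tendsto (fun i => d ^ p * (ε i * A d + d * B d)) l
        (nhds (d ^ p * (0 * A d + d * B d))) :=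
      ((hε.mul_const _).add_const _).const_mul _
    have hlt : d ^ p * (0 * A d + d * B d) < K := by
      rw [← hroot₀, zero_mul, zero_add]
      have hBd : B d ≤ B ξ₀ := hBm hd0 hξ₀ hdξ.le
      have h1 : d * B d < ξ₀ * B ξ₀ :=
        mul_lt_mul hdξ hBd (hB d hd0) hξ₀.le
      have hpow := Real.rpow_le_rpow hd0.le hdξ.le hp
      exact mul_lt_mul' hpow h1 (mul_pos hd0 (hB d hd0)).le (Real.rpow_pos_of_pos hξ₀ p)
    filter_upwards [hlim.eventually_lt_const hlt, hεpos, hξ, hroot] with i hi hεi hξi hri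
    by_contra! hle
    have hξd : ξ i ≤ d := hle.trans (le_max_left _ _)
    have hAd : A (ξ i) ≤ A d := hAm hξi hd0 hξd
    have hBd : B (ξ i) ≤ B d := hBm hξi hd0 hξd
    have := hA (ξ i) hξi
    have := hB (ξ i) hξi
    refine absurd hi (not_lt.2 ?_)
    rw [← hri]
    gcongr
  · filter_upwards [hεpos, hξ, hroot] with i hεi hξi hri
    refine lt_of_le_of_lt ?_ hc
    by_contra! hlt
    have hBi : B ξ₀ ≤ B (ξ i) := hBm hξ₀ hξi hlt.le
    have := hB ξ₀ hξ₀
    have hεA := mul_pos hεi (hA (ξ i) hξi)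
    have hpow := Real.rpow_le_rpow hξ₀.le hlt.le hp
    have h1 : ξ₀ * B ξ₀ < ε i * A (ξ i) + ξ i * B (ξ i) := by
      have : ξ₀ * B ξ₀ ≤ ξ i * B (ξ i) := by gcongr
      linarith
    have := mul_lt_mul' hpow h1 (by positivity) (Real.rpow_pos_of_pos hξi p)
    linarith

/-- Theorem 4.1 (convergence of the Robin solution to the Dirichlet solution): for every
`t > 0`, `s_R(t,h₀) → s_{D∞}(t)` as `h₀ → +∞`, and for every `t > 0`, `x > 0`,
`u_R(x,t,h₀) → u_{D∞}(x,t)` as `h₀ → +∞`. -/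
theorem stmt19 (β δ k a γ uinf : ℝ) (hβ : β ≥ max δ (-1 - δ))
    (hk : 0 < k) (ha : 0 < a) (hγ : 0 < γ) (huinf : 0 < uinf)
    (α : ℝ) (hα : α = β - δ)
    (ξR : ℝ → ℝ)
    (hξR : ∀ h₀ : ℝ, 0 < h₀ → 0 < ξR h₀ ∧
      (k * uinf / (γ * (2:ℝ) ^ (β + 1) * a ^ (β + δ + 2))) *
        (1 / ((k / (2 * a * h₀)) * kummerM (α/2 + 1/2) (1/2) ((ξR h₀)^2) +
          ξR h₀ * kummerM (α/2 + 1) (3/2) ((ξR h₀)^2))) = (ξR h₀) ^ (β + δ + 1))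
    (ξD : ℝ) (hξDpos : 0 < ξD)
    (hξD : (k * uinf / (γ * (2:ℝ) ^ (β + 1) * a ^ (β + δ + 2))) *
      (1 / (ξD * kummerM (α/2 + 1) (3/2) (ξD^2))) = ξD ^ (β + δ + 1))
    (D C₁R C₂R : ℝ → ℝ)
    (hD : D = fun h₀ => (k / (2 * a * h₀)) * kummerM (-α/2) (1/2) (-(ξR h₀)^2) +
      ξR h₀ * kummerM (-α/2 + 1/2) (3/2) (-(ξR h₀)^2))
    (hC₁ : C₁R = fun h₀ =>
      uinf * ξR h₀ * kummerM (-α/2 + 1/2) (3/2) (-(ξR h₀)^2) / D h₀)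
    (hC₂ : C₂R = fun h₀ => -uinf * kummerM (-α/2) (1/2) (-(ξR h₀)^2) / D h₀)
    (sR : ℝ → ℝ → ℝ) (hsR : sR = fun t h₀ => 2 * ξR h₀ * a * Real.sqrt t)
    (uR : ℝ → ℝ → ℝ → ℝ)
    (huR : uR = fun x t h₀ => t ^ (α/2) *
      (C₁R h₀ * kummerM (-α/2) (1/2) (-(x / (2 * a * Real.sqrt t))^2) +
       C₂R h₀ * (x / (2 * a * Real.sqrt t)) *
         kummerM (-α/2 + 1/2) (3/2) (-(x / (2 * a * Real.sqrt t))^2)))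
    (sD : ℝ → ℝ) (hsD : sD = fun t => 2 * ξD * a * Real.sqrt t)
    (uD : ℝ → ℝ → ℝ)
    (huD : uD = fun x t => t ^ (α/2) *
      (uinf * kummerM (-α/2) (1/2) (-(x / (2 * a * Real.sqrt t))^2) -
       (uinf * kummerM (-α/2) (1/2) (-ξD^2) /
          (ξD * kummerM (-α/2 + 1/2) (3/2) (-ξD^2))) *
         (x / (2 * a * Real.sqrt t)) *
         kummerM (-α/2 + 1/2) (3/2) (-(x / (2 * a * Real.sqrt t))^2))) :
    (∀ t : ℝ, 0 < t →
      Filter.Tendsto (fun h₀ => sR t h₀) Filter.atTop (nhds (sD t))) ∧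
    (∀ t x : ℝ, 0 < t → 0 < x →
      Filter.Tendsto (fun h₀ => uR x t h₀) Filter.atTop (nhds (uD x t))) := by
  have hα0 : 0 ≤ α := by
    rw [hα]; linarith [(le_max_left δ (-1 - δ)).trans hβ]
  have hp : 0 ≤ β + δ + 1 := by linarith [(le_max_right δ (-1 - δ)).trans hβ]
  set K := k * uinf / (γ * (2:ℝ) ^ (β + 1) * a ^ (β + δ + 2))
  have hε : Filter.Tendsto (fun h₀ : ℝ => k / (2 * a * h₀)) Filter.atTop (nhds 0) :=
    tendsto_const_nhds.div_atTop (Filter.tendsto_id.const_mul_atTop (by positivity))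
  have hApos (z : ℝ) : 0 < kummerM (α/2 + 1/2) (1/2) (z^2) :=
    one_pos.trans_le (one_le_kummerM (by positivity) (by norm_num) (sq_nonneg z))
  have hBpos (z : ℝ) : 0 < kummerM (α/2 + 1) (3/2) (z^2) :=
    one_pos.trans_le (one_le_kummerM (by positivity) (by norm_num) (sq_nonneg z))
  have hpos := Filter.eventually_gt_atTop (0 : ℝ)
  have hξ : Filter.Tendsto ξR Filter.atTop (nhds ξD) := by
    refine tendsto_root_of_monotone (A := fun z => kummerM (α/2 + 1/2) (1/2) (z^2))
      (B := fun z => kummerM (α/2 + 1) (3/2) (z^2)) (K := K) hp hξDpos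
      (fun z _ => hApos z) (fun z _ => hBpos z) (fun z hz w _ hzw => ?_)
      (fun z hz w _ hzw => ?_) hε (hpos.mono fun h hh => by positivity)
      (hpos.mono fun h hh => (hξR h hh).1) (hpos.mono fun h hh => ?_) ?_
    · exact kummerM_le_kummerM_s19 (by positivity) (by norm_num) (sq_nonneg z)
        (pow_le_pow_left₀ (le_of_lt hz) hzw 2)
    · exact kummerM_le_kummerM_s19 (by positivity) (by norm_num) (sq_nonneg z)
        (pow_le_pow_left₀ (le_of_lt hz) hzw 2)
    · obtain ⟨hξpos, heq⟩ := hξR h hh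
      have := hApos (ξR h)
      have := hBpos (ξR h)
      rw [← heq, mul_assoc, one_div_mul_cancel (by positivity), mul_one]
    · have := hBpos ξD
      rw [← hξD, mul_assoc, one_div_mul_cancel (by positivity), mul_one]
  have hM₁ : Filter.Tendsto (fun h₀ => kummerM (-α/2) (1/2) (-(ξR h₀)^2)) Filter.atTop
      (nhds (kummerM (-α/2) (1/2) (-ξD^2))) :=
    ((continuous_kummerM _ (by norm_num)).tendsto _).comp (hξ.pow 2).neg
  have hM₂ : Filter.Tendsto (fun h₀ => kummerM (-α/2 + 1/2) (3/2) (-(ξR h₀)^2)) Filter.atTop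
      (nhds (kummerM (-α/2 + 1/2) (3/2) (-ξD^2))) :=
    ((continuous_kummerM _ (by norm_num)).tendsto _).comp (hξ.pow 2).neg
  have hN : 0 < kummerM (-α/2 + 1/2) (3/2) (-ξD^2) :=
    kummerM_neg_pos (by norm_num) (by linarith) (sq_nonneg ξD)
  have hDlim : Filter.Tendsto D Filter.atTop
      (nhds (ξD * kummerM (-α/2 + 1/2) (3/2) (-ξD^2))) := by
    rw [hD]
    simpa using (hε.mul hM₁).add (hξ.mul hM₂)
  have hD0 : ξD * kummerM (-α/2 + 1/2) (3/2) (-ξD^2) ≠ 0 := (mul_pos hξDpos hN).ne'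
  have hC₁lim : Filter.Tendsto C₁R Filter.atTop (nhds uinf) := by
    have h := ((hξ.const_mul uinf).mul hM₂).div hDlim hD0
    rw [mul_assoc, mul_div_assoc, div_self hD0, mul_one] at h
    rw [hC₁]
    exact h
  have hC₂lim : Filter.Tendsto C₂R Filter.atTop (nhds (-uinf * kummerM (-α/2) (1/2) (-ξD^2) /
      (ξD * kummerM (-α/2 + 1/2) (3/2) (-ξD^2)))) := by
    rw [hC₂]
    exact (hM₁.const_mul (-uinf)).div hDlim hD0
  refine ⟨fun t _ => ?_, fun t x _ _ => ?_⟩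
  · rw [hsR, hsD]
    exact ((hξ.const_mul 2).mul_const a).mul_const _
  · rw [huR, huD]
    convert (((hC₁lim.mul_const _).add ((hC₂lim.mul_const _).mul_const _)).const_mul
      (t ^ (α/2))) using 2
    ring
end
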